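/- arXiv:0909.1415 — 2 statements merged into one kernel-verified Lean document; each statement's English description precedes it below -/
import Mathlib

section
/- The diagonal map Δ defined on a singular n-cube f by Δ(f) = Σ_G ρ_{GK} (f ∘ λ_G^0) ⊗ (f ∘ λ_K^1), where the sum runs over all subsets G ⊆ {1,...,n}, K is the complement of G, and ρ_{GK} is the sign of the shuffle permutation (G,K) of (1,...,n), is a chain map from the cubical chain complex of X to its tensor square (with the tensor-product differential ∂(x⊗x') = ∂x⊗x' + (−1)^{dim x} x⊗∂x'). -/
/- A precubical set: sets `X n` with face maps `∂_i^ε : X (n+1) → X n` (`i : Fin (n+1)`,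
0-based) satisfying the precubical identities. -/
structure Precubical where
  X : ℕ → Type
  face : ∀ n, Fin (n + 1) → Bool → X (n + 1) → X n
  comm : ∀ n (i : Fin (n + 1)) (j : Fin (n + 2)) (hij : (i : ℕ) < (j : ℕ))
    (α β : Bool) (x : X (n + 2)),
    face n i α (face (n + 1) j β x) =
      face n ⟨(j : ℕ) - 1, by omega⟩ β (face (n + 1) ⟨(i : ℕ), by omega⟩ α x)

/- Remove index `i`, shifting the indices above `i` down by one. -/
def dropAt {m : ℕ} (i : Fin (m + 1)) (x : Fin (m + 1)) (hx : x ≠ i) : Fin m :=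
  if h : (x : ℕ) < (i : ℕ) then ⟨x, by omega⟩
  else ⟨(x : ℕ) - 1, by
    have hx' : (x : ℕ) ≠ (i : ℕ) := fun he => hx (Fin.ext he)
    have := x.isLt; omega⟩

/- `mfaceAux C k G _ ε x` is the iterated face `x ∘ λ_G^ε` of the cube `x`, obtained by
deleting (with value `ε`) the coordinates not in `G`, from the largest one down;
`k` counts the number of deletions. -/
noncomputable def mfaceAux (C : Precubical) :
    (k : ℕ) → {n : ℕ} → (G : Finset (Fin n)) → n - G.card = k → Bool → C.X n → C.X G.card
  | 0, n, G, h, _, x =>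
      cast (congrArg C.X (by have := Finset.card_le_univ G; simp at this; omega)) x
  | _+1, 0, _, h, _, _ => absurd h (by omega)
  | k+1, n'+1, G, h, ε, x =>
      have hne : Gᶜ.Nonempty := Finset.card_pos.mp (by
        rw [Finset.card_compl]; simp only [Fintype.card_fin]; omega)
      have hiG : Gᶜ.max' hne ∉ G := by simpa using Gᶜ.max'_mem hne
      have hinj : Function.Injective
          (fun y : {a // a ∈ G} => dropAt (Gᶜ.max' hne) y.1 (fun he => hiG (he ▸ y.2))) := by
        intro a b hab
        apply Subtype.ext; apply Fin.ext
        unfold dropAt at hab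
        simp only at hab
        have ha : (a.1 : ℕ) ≠ (Gᶜ.max' hne : ℕ) :=
          fun he => hiG (Fin.ext he ▸ a.2)
        have hb : (b.1 : ℕ) ≠ (Gᶜ.max' hne : ℕ) :=
          fun he => hiG (Fin.ext he ▸ b.2)
        split_ifs at hab <;> (simp only [Fin.mk.injEq] at hab; omega)
      have hcard : (G.attach.image
          (fun y : {a // a ∈ G} => dropAt (Gᶜ.max' hne) y.1 (fun he => hiG (he ▸ y.2)))).card
          = G.card := by
        rw [Finset.card_image_of_injective _ hinj, Finset.card_attach]
      cast (congrArg C.X hcard)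
        (mfaceAux C k
          (G.attach.image (fun y : {a // a ∈ G} => dropAt (Gᶜ.max' hne) y.1 (fun he => hiG (he ▸ y.2))))
          (by rw [hcard]; have := Finset.card_le_univ G; simp at this; omega)
          ε (C.face n' (Gᶜ.max' hne) ε x))

/- `mface C G ε x = x ∘ λ_G^ε`, the `G.card`-dimensional face of the cube `x` in which all
coordinates outside `G` are set to `ε`. -/
noncomputable def mface (C : Precubical) {n : ℕ} (G : Finset (Fin n)) (ε : Bool)
    (x : C.X n) : C.X G.card :=
  mfaceAux C (n - G.card) G rfl ε x

/- `ρ_{GK}`: the sign of the shuffle permutation listing the elements of `G` in increasing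
order followed by those of its complement `K`, computed as `(-1)^inversions`. -/
def shuffleSign {n : ℕ} (G : Finset (Fin n)) : ℤ :=
  (-1) ^ (∑ g ∈ G, (Gᶜ.filter (· < g)).card)

/- The cubical cup product `(φ ⌣ ψ)(u) = Σ_{|G|=p} ρ_{GK} φ(u∘λ_G^0) ψ(u∘λ_K^1)`. -/
noncomputable def cup (C : Precubical) {R : Type} [NonUnitalNonAssocRing R] {p q : ℕ}
    (φ : C.X p → R) (ψ : C.X q → R) (u : C.X (p + q)) : R :=
  ∑ G : Finset (Fin (p + q)),
    if h : G.card = p then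
      shuffleSign G •
        (φ (cast (congrArg C.X h) (mface C G false u)) *
         ψ (cast (congrArg C.X (by rw [Finset.card_compl]; simp only [Fintype.card_fin]; omega))
              (mface C Gᶜ true u)))
    else 0

/- The cubical coboundary `δ = Σ_{i=1}^{n+1} (−1)^i (δ_i^1 − δ_i^0)`,
`(δ_i^ε f)(ϑ) = f(∂_i^ε ϑ)` (0-based `i`, hence sign `(−1)^{i+1}`). -/
def cobnd (C : Precubical) {R : Type} [NonUnitalNonAssocRing R] {n : ℕ}
    (f : C.X n → R) (ϑ : C.X (n + 1)) : R :=
  ∑ i : Fin (n + 1), (-1 : ℤ) ^ ((i : ℕ) + 1) •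
    (f (C.face n i true ϑ) - f (C.face n i false ϑ))

/- The boundary operator `D = Σ_i (−1)^{i+1}(D_i^1 − D_i^0)` as an additive homomorphism of
the free abelian groups on the cubes. -/
noncomputable def Dhom (C : Precubical) (p : ℕ) : (C.X (p + 1) →₀ ℤ) →+ (C.X p →₀ ℤ) :=
  ∑ i : Fin (p + 1), (-1 : ℤ) ^ ((i : ℕ) + 1) •
    (Finsupp.mapDomain.addMonoidHom (C.face p i true) -
     Finsupp.mapDomain.addMonoidHom (C.face p i false))

/- Index set of the degree-`n` part of the tensor square. -/
abbrev TIdx (n : ℕ) := {x : ℕ × ℕ // x.1 + x.2 = n}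

/- Degree-`n` part `⊕_{p+q=n} ℤ[X_p] ⊗ ℤ[X_q]` of the tensor square of the cubical chain
complex. -/
abbrev TT (C : Precubical) (n : ℕ) : Type :=
  DirectSum (TIdx n) (fun pq => TensorProduct ℤ (C.X pq.1.1 →₀ ℤ) (C.X pq.1.2 →₀ ℤ))

/- Left component `Dx ⊗ x'` of the tensor-product differential. -/
noncomputable def tcompL (C : Precubical) (n q : ℕ) :
    (p : ℕ) → p + q = n + 1 →
      (TensorProduct ℤ (C.X p →₀ ℤ) (C.X q →₀ ℤ) →+ TT C n)
  | 0, _ => 0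
  | p' + 1, h =>
    ((DirectSum.lof ℤ (TIdx n)
        (fun pq => TensorProduct ℤ (C.X pq.1.1 →₀ ℤ) (C.X pq.1.2 →₀ ℤ))
        ⟨(p', q), by omega⟩).comp
      (TensorProduct.map (Dhom C p').toIntLinearMap LinearMap.id)).toAddMonoidHom

/- Right component `x ⊗ Dx'` of the tensor-product differential. -/
noncomputable def tcompR (C : Precubical) (n p : ℕ) :
    (q : ℕ) → p + q = n + 1 →
      (TensorProduct ℤ (C.X p →₀ ℤ) (C.X q →₀ ℤ) →+ TT C n)
  | 0, _ => 0
  | q' + 1, h =>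
    ((DirectSum.lof ℤ (TIdx n)
        (fun pq => TensorProduct ℤ (C.X pq.1.1 →₀ ℤ) (C.X pq.1.2 →₀ ℤ))
        ⟨(p, q'), by omega⟩).comp
      (TensorProduct.map LinearMap.id (Dhom C q').toIntLinearMap)).toAddMonoidHom

/- The tensor-product differential `∂(x⊗x') = ∂x⊗x' + (−1)^{dim x} x⊗∂x'`. -/
noncomputable def tdiffT (C : Precubical) (n : ℕ) : TT C (n + 1) →+ TT C n :=
  DirectSum.toAddMonoid fun pq =>
    tcompL C n pq.1.2 pq.1.1 pq.2 + (-1 : ℤ) ^ pq.1.1 • tcompR C n pq.1.1 pq.1.2 pq.2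

/- The diagonal `Δ(f) = Σ_G ρ_{GK} (f∘λ_G^0) ⊗ (f∘λ_K^1)` on a single cube. -/
noncomputable def diag0 (C : Precubical) {n : ℕ} (u : C.X n) : TT C n :=
  ∑ G : Finset (Fin n), shuffleSign G •
    DirectSum.of (fun pq : TIdx n => TensorProduct ℤ (C.X pq.1.1 →₀ ℤ) (C.X pq.1.2 →₀ ℤ))
      ⟨(G.card, Gᶜ.card), by have := Finset.card_add_card_compl G; simpa using this⟩
      (Finsupp.single (mface C G false u) 1 ⊗ₜ[ℤ] Finsupp.single (mface C Gᶜ true u) 1)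

/- The diagonal, extended additively to the chain group. -/
noncomputable def diag (C : Precubical) (n : ℕ) : (C.X n →₀ ℤ) →+ TT C n :=
  Finsupp.liftAddHom fun u => (zmultiplesHom (TT C n)) (diag0 C u)

namespace Precubical

open Finset

variable (C : Precubical)

/-- The face `x ∘ λ_G^ε`, packaged with its dimension. -/
noncomputable def sigmaFace {n : ℕ} (G : Finset (Fin n)) (ε : Bool) (x : C.X n) : Σ m, C.X m :=
  ⟨G.card, mface C G ε x⟩

/-- The subset of `Fin (n + 1)` avoiding `g` that corresponds to `H : Finset (Fin n)`. -/
abbrev skip {n : ℕ} (g : Fin (n + 1)) (H : Finset (Fin n)) : Finset (Fin (n + 1)) :=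
  H.map g.succAboveEmb

/-- The face operator `∂_a^δ` on cubes packaged with their dimension. -/
def sigmaD (a : ℕ) (δ : Bool) : (Σ m, C.X m) → Σ m, C.X m
  | ⟨0, x⟩ => ⟨0, x⟩
  | ⟨m + 1, x⟩ => ⟨m, C.face m (Fin.ofNat (m + 1) a) δ x⟩

theorem sigma_mk_cast {a b : ℕ} (h : a = b) (x : C.X a) :
    (⟨b, cast (congrArg C.X h) x⟩ : Σ m, C.X m) = ⟨a, x⟩ := by
  subst h; rfl

theorem sigmaFace_eq_mfaceAux {n k : ℕ} (G : Finset (Fin n)) (h : n - G.card = k) (ε : Bool)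
    (x : C.X n) : C.sigmaFace G ε x = ⟨G.card, mfaceAux C k G h ε x⟩ := by
  subst h; rfl

theorem sigmaFace_univ {n : ℕ} (ε : Bool) (x : C.X n) : C.sigmaFace univ ε x = ⟨n, x⟩ := by
  rw [C.sigmaFace_eq_mfaceAux (k := 0) univ (by simp), mfaceAux]
  exact C.sigma_mk_cast (by simp) x

theorem succAbove_dropAt {m : ℕ} (i x : Fin (m + 1)) (hx : x ≠ i) :
    i.succAbove (dropAt i x hx) = x := by
  have : (x : ℕ) ≠ i := fun h => hx (Fin.ext h)
  unfold dropAt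
  split_ifs with h <;> ext <;> simp only [Fin.succAbove, Fin.lt_def] <;> split_ifs <;>
    simp_all <;> omega

theorem dropAt_eq_iff {m : ℕ} {i g x : Fin (m + 1)} (hi : i = g) (hx : x ≠ i) {j : Fin m} :
    dropAt i x hx = j ↔ x = g.succAbove j := by
  subst hi
  rw [← i.succAbove_right_inj, succAbove_dropAt]

theorem sigmaFace_skip_of_max {n : ℕ} (H : Finset (Fin n)) (g : Fin (n + 1))
    (hg : ∀ j ∉ skip g H, j ≤ g) (ε : Bool) (x : C.X (n + 1)) :
    C.sigmaFace (skip g H) ε x = C.sigmaFace H ε (C.face n g ε x) := by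
  have hc : (skip g H).card = H.card := card_map _
  have hle : H.card ≤ n := by simpa using card_le_univ H
  rw [C.sigmaFace_eq_mfaceAux (k := n - H.card + 1) (skip g H) (by omega), mfaceAux]
  have hne : (skip g H)ᶜ.Nonempty := ⟨g, by simp⟩
  have hm : (skip g H)ᶜ.max' hne = g :=
    le_antisymm (hg _ (by simpa using max'_mem _ hne)) (le_max' _ _ (by simp))
  rw [C.sigma_mk_cast, ← C.sigmaFace_eq_mfaceAux]
  · refine congrArg₂ (fun A m => C.sigmaFace A ε (C.face n m ε x)) ?_ hm
    ext j
    simp only [mem_image, mem_attach, true_and, Subtype.exists, dropAt_eq_iff hm]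
    simp
  · rw [card_image_of_injective, card_attach]
    intro a b hab
    rw [dropAt_eq_iff rfl, succAbove_dropAt] at hab
    exact Subtype.ext hab

theorem exists_swap {n : ℕ} (g : Fin (n + 2)) (m : Fin (n + 1)) :
    ∃ g' : Fin (n + 1), (g.succAbove m).succAbove g' = g ∧
      (∀ k, g.succAbove (m.succAbove k) = (g.succAbove m).succAbove (g'.succAbove k)) ∧
      ∀ (α β : Bool) (x : C.X (n + 2)), C.face n g' α (C.face (n + 1) (g.succAbove m) β x) =
        C.face n m β (C.face (n + 1) g α x) := by
  rcases lt_or_ge (m : ℕ) g with h | h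
  · have hs : g.succAbove m = m.castSucc := Fin.succAbove_of_castSucc_lt _ _ h
    rw [hs]
    refine ⟨⟨g - 1, by omega⟩, ?_, ?_, ?_⟩
    · ext; simp only [Fin.succAbove, Fin.lt_def]; split_ifs <;> simp_all <;> omega
    · intro k
      ext; simp only [Fin.succAbove, Fin.lt_def]
      split_ifs <;> simp_all <;> omega
    · intro α β x
      exact (C.comm n m g h β α x).symm
  · have hs : g.succAbove m = m.succ := Fin.succAbove_of_le_castSucc _ _ h
    rw [hs]
    refine ⟨⟨g, by omega⟩, ?_, ?_, ?_⟩
    · ext; simp only [Fin.succAbove, Fin.lt_def]; split_ifs <;> simp_all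
    · intro k
      ext; simp only [Fin.succAbove, Fin.lt_def]
      split_ifs <;> simp_all <;> omega
    · intro α β x
      exact C.comm n ⟨g, by omega⟩ m.succ (by simp; omega) α β x

theorem exists_eq_skip {n : ℕ} (G : Finset (Fin (n + 1))) (g : Fin (n + 1)) (hg : g ∉ G) :
    ∃ H, G = skip g H := by
  refine ⟨univ.filter fun j => g.succAbove j ∈ G, ?_⟩
  ext j
  rcases Fin.eq_self_or_eq_succAbove g j with rfl | ⟨k, rfl⟩ <;> simp_all

theorem skip_skip {n : ℕ} {g : Fin (n + 2)} {m g' : Fin (n + 1)}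
    (h : ∀ k, g.succAbove (m.succAbove k) = (g.succAbove m).succAbove (g'.succAbove k))
    (H : Finset (Fin n)) : skip g (skip m H) = skip (g.succAbove m) (skip g' H) := by
  simp only [skip, map_map]
  congr 1
  ext k
  simp [h]

theorem sigmaFace_skip {n : ℕ} (H : Finset (Fin n)) (g : Fin (n + 1)) (ε : Bool)
    (x : C.X (n + 1)) :
    C.sigmaFace (skip g H) ε x = C.sigmaFace H ε (C.face n g ε x) := by
  induction n with
  | zero => exact C.sigmaFace_skip_of_max H g (fun j _ => by omega) ε x
  | succ n ih =>
    have hne : (skip g H)ᶜ.Nonempty := ⟨g, by simp⟩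
    have hmax : ∀ j ∉ skip g H, j ≤ (skip g H)ᶜ.max' hne :=
      fun j hj => le_max' _ _ (by simpa using hj)
    have hmem : (skip g H)ᶜ.max' hne ∉ skip g H := by simpa using max'_mem _ hne
    generalize (skip g H)ᶜ.max' hne = m at hmax hmem
    rcases Fin.eq_self_or_eq_succAbove g m with rfl | ⟨k, rfl⟩
    · exact C.sigmaFace_skip_of_max H m hmax ε x
    · obtain ⟨H, rfl⟩ := exists_eq_skip H k (by simpa using hmem)
      obtain ⟨g', -, hs, hf⟩ := C.exists_swap g k
      rw [skip_skip hs] at hmax ⊢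
      rw [C.sigmaFace_skip_of_max _ _ hmax, ih, ih, hf]

/-- The number of elements of `G` below `g`. -/
abbrev rank {n : ℕ} (G : Finset (Fin n)) (g : Fin n) : ℕ := (G.filter (· < g)).card

theorem rank_skip_succAbove {n : ℕ} (m : Fin (n + 1)) (G : Finset (Fin n)) (g : Fin n) :
    rank (skip m G) (m.succAbove g) = rank G g := by
  simp [rank, skip, filter_map, Function.comp_def]

theorem rank_insert_self {n : ℕ} (G : Finset (Fin n)) (g : Fin n) :
    rank (insert g G) g = rank G g := by
  simp [rank, filter_insert]

theorem sigmaD_sigmaFace_insert {n : ℕ} (H : Finset (Fin n)) (g : Fin (n + 1)) (ε δ : Bool)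
    (x : C.X (n + 1)) :
    C.sigmaD (rank (skip g H) g) δ (C.sigmaFace (insert g (skip g H)) ε x) =
      C.sigmaFace H ε (C.face n g δ x) := by
  by_cases hH : H = univ
  · subst hH
    have hu : insert g (skip g univ) = univ := by
      ext j; rcases Fin.eq_self_or_eq_succAbove g j with rfl | ⟨k, rfl⟩ <;> simp
    have hr : rank (skip g univ) g = g := by
      rw [← rank_insert_self, hu]
      rw [rank, filter_gt_eq_Iio, Fin.card_Iio]
    rw [hu, hr, sigmaFace_univ, sigmaFace_univ, sigmaD]
    simp
  · obtain ⟨m, hm⟩ : ∃ m, m ∉ H := by simpa [eq_univ_iff_forall] using hH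
    cases n with
    | zero => exact m.elim0
    | succ n =>
      obtain ⟨H, rfl⟩ := exists_eq_skip H m hm
      obtain ⟨g', hg', hs, hf⟩ := C.exists_swap g m
      have hi : insert g (skip g (skip m H)) =
          skip (g.succAbove m) (insert g' (skip g' H)) := by
        rw [skip_skip hs]
        simp only [skip, map_insert, Fin.coe_succAboveEmb, hg']
      have hr := rank_skip_succAbove (g.succAbove m) (skip g' H) g'
      rw [hg', ← skip_skip hs] at hr
      rw [hi, hr, sigmaFace_skip, sigmaFace_skip, ← hf]
      exact sigmaD_sigmaFace_insert H g' ε δ _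

theorem sum_range_card {n : ℕ} {M : Type*} [AddCommMonoid M] (G : Finset (Fin n)) (f : ℕ → M) :
    ∑ a ∈ range G.card, f a = ∑ g ∈ G, f (rank G g) := by
  induction G using Finset.induction_on_max with
  | empty => simp
  | insert m G h ih =>
    have hm : m ∉ G := fun hh => lt_irrefl _ (h m hh)
    rw [card_insert_of_notMem hm, sum_range_succ, sum_insert hm, add_comm, ih, rank_insert_self,
      rank, filter_true_of_mem h]
    congr 1
    refine sum_congr rfl fun g hg => ?_
    rw [rank, rank, filter_insert, if_neg (h g hg).not_gt]

theorem sum_mem_eq_sum_insert_skip {n : ℕ} {M : Type*} [AddCommMonoid M] (g : Fin (n + 1))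
    (F : Finset (Fin (n + 1)) → M) :
    ∑ G with g ∈ G, F G = ∑ H, F (insert g (skip g H)) := by
  symm
  refine sum_nbij (fun H => insert g (skip g H)) (by simp) ?_ ?_ (by simp)
  · intro H _ H' _ h
    have := congrArg (Finset.erase · g) h
    simpa using this
  · intro G hG
    obtain ⟨H, hH⟩ := exists_eq_skip (G.erase g) g (by simp)
    refine ⟨H, by simp, ?_⟩
    simp only [← hH]
    exact insert_erase (by simpa using hG)

theorem sum_notMem_eq_sum_skip {n : ℕ} {M : Type*} [AddCommMonoid M] (g : Fin (n + 1))
    (F : Finset (Fin (n + 1)) → M) :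
    ∑ G with g ∉ G, F G = ∑ H, F (skip g H) := by
  symm
  refine sum_nbij (skip g) (by simp) ?_ ?_ (by simp)
  · intro H _ H' _ h
    simpa using h
  · intro G hG
    obtain ⟨H, rfl⟩ := exists_eq_skip G g (by simpa using hG)
    exact ⟨H, by simp, rfl⟩

theorem compl_insert_skip {n : ℕ} (g : Fin (n + 1)) (H : Finset (Fin n)) :
    (insert g (skip g H))ᶜ = skip g Hᶜ := by
  ext j; rcases Fin.eq_self_or_eq_succAbove g j with rfl | ⟨k, rfl⟩ <;> simp

theorem compl_skip {n : ℕ} (g : Fin (n + 1)) (H : Finset (Fin n)) :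
    (skip g H)ᶜ = insert g (skip g Hᶜ) := by
  ext j; rcases Fin.eq_self_or_eq_succAbove g j with rfl | ⟨k, rfl⟩ <;> simp

theorem rank_skip_add_rank_skip_compl {n : ℕ} (g : Fin (n + 1)) (H : Finset (Fin n)) :
    rank (skip g H) g + rank (skip g Hᶜ) g = g := by
  rw [← rank_insert_self (skip g Hᶜ), ← compl_skip]
  have h := card_union_of_disjoint (disjoint_filter_filter (p := (· < g)) (q := (· < g))
    (disjoint_compl_right (a := skip g H)))
  rw [← filter_union, union_compl] at h
  rw [filter_gt_eq_Iio, Fin.card_Iio] at h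
  exact h.symm

theorem shuffleSign_insert_skip {n : ℕ} (g : Fin (n + 1)) (H : Finset (Fin n)) :
    shuffleSign (insert g (skip g H)) = shuffleSign H * (-1) ^ rank (skip g Hᶜ) g := by
  unfold shuffleSign
  rw [compl_insert_skip, sum_insert (by simp), sum_map, ← pow_add, add_comm]
  congr 2
  exact sum_congr rfl fun h _ => rank_skip_succAbove g Hᶜ h

theorem shuffleSign_skip {n : ℕ} (g : Fin (n + 1)) (H : Finset (Fin n)) :
    shuffleSign (skip g H) = shuffleSign H * (-1) ^ (H.card + rank (skip g H) g) := by
  have key : ∑ h ∈ skip g H, rank (skip g H)ᶜ h + rank (skip g H) g =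
      ∑ h ∈ H, rank Hᶜ h + H.card := by
    rw [compl_skip, sum_map]
    have h1 : ∀ h ∈ H, rank (insert g (skip g Hᶜ)) (g.succAboveEmb h) =
        rank Hᶜ h + if g < g.succAbove h then 1 else 0 := by
      intro h _
      rw [← rank_skip_succAbove g, rank, filter_insert, Fin.coe_succAboveEmb]
      split_ifs
      · rw [card_insert_of_notMem (by simp)]
      · rfl
    rw [sum_congr rfl h1, sum_add_distrib, add_assoc]
    congr 1
    rw [← card_filter, rank, skip, filter_map, card_map,
      ← card_filter_add_card_filter_not (s := H) (fun h => g < g.succAbove h)]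
    congr 2
    ext h
    simp only [not_lt, le_iff_lt_or_eq, g.succAbove_ne, or_false, mem_filter]
    rfl
  unfold shuffleSign
  have h2 : (-1 : ℤ) ^ (∑ h ∈ skip g H, rank (skip g H)ᶜ h + rank (skip g H) g) *
      (-1) ^ rank (skip g H) g = (-1) ^ (∑ h ∈ H, rank Hᶜ h + H.card) *
      (-1) ^ rank (skip g H) g := by rw [key]
  rw [pow_add, mul_assoc, ← mul_pow] at h2
  simpa [pow_add, mul_assoc] using h2

/-- The basis element `x ⊗ y` of the tensor square; zero if its degree is not `n`. -/
noncomputable def tmul (n : ℕ) (x y : Σ m, C.X m) : TT C n :=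
  if h : x.1 + y.1 = n then
    DirectSum.of (fun pq : TIdx n => TensorProduct ℤ (C.X pq.1.1 →₀ ℤ) (C.X pq.1.2 →₀ ℤ))
      ⟨(x.1, y.1), h⟩ (Finsupp.single x.2 1 ⊗ₜ[ℤ] Finsupp.single y.2 1)
  else 0

theorem tmul_mk {n p q : ℕ} (h : p + q = n) (x : C.X p) (y : C.X q) :
    C.tmul n ⟨p, x⟩ ⟨q, y⟩ =
      DirectSum.of (fun pq : TIdx n => TensorProduct ℤ (C.X pq.1.1 →₀ ℤ) (C.X pq.1.2 →₀ ℤ))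
        ⟨(p, q), h⟩ (Finsupp.single x 1 ⊗ₜ[ℤ] Finsupp.single y 1) :=
  dif_pos h

theorem diag0_eq {n : ℕ} (u : C.X n) :
    diag0 C u = ∑ G, shuffleSign G • C.tmul n (C.sigmaFace G false u) (C.sigmaFace Gᶜ true u) := by
  unfold diag0
  refine sum_congr rfl fun G _ => ?_
  rw [sigmaFace, sigmaFace, tmul_mk]

theorem Dhom_single (p : ℕ) (x : C.X (p + 1)) :
    Dhom C p (Finsupp.single x 1) = ∑ i : Fin (p + 1), (-1 : ℤ) ^ ((i : ℕ) + 1) •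
      (Finsupp.single (C.face p i true x) 1 - Finsupp.single (C.face p i false x) 1) := by
  simp [Dhom, Finsupp.mapDomain_single]

theorem tcompL_single (n q p : ℕ) (h : p + q = n + 1) (x : C.X p) (y : C.X q) :
    tcompL C n q p h (Finsupp.single x 1 ⊗ₜ[ℤ] Finsupp.single y 1) =
      ∑ a ∈ range p, (-1 : ℤ) ^ (a + 1) •
        (C.tmul n (C.sigmaD a true ⟨p, x⟩) ⟨q, y⟩ -
          C.tmul n (C.sigmaD a false ⟨p, x⟩) ⟨q, y⟩) := by
  cases p with
  | zero => simp [tcompL]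
  | succ p =>
    have hp : p + q = n := by omega
    rw [← Fin.sum_univ_eq_sum_range (fun a => (-1 : ℤ) ^ (a + 1) •
        (C.tmul n (C.sigmaD a true ⟨p + 1, x⟩) ⟨q, y⟩ -
          C.tmul n (C.sigmaD a false ⟨p + 1, x⟩) ⟨q, y⟩))]
    have hL : tcompL C n q (p + 1) h (Finsupp.single x 1 ⊗ₜ[ℤ] Finsupp.single y 1) =
        DirectSum.of (fun pq : TIdx n => TensorProduct ℤ (C.X pq.1.1 →₀ ℤ) (C.X pq.1.2 →₀ ℤ))
          ⟨(p, q), hp⟩ (Dhom C p (Finsupp.single x 1) ⊗ₜ[ℤ] Finsupp.single y 1) := rfl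
    rw [hL, Dhom_single, TensorProduct.sum_tmul, map_sum]
    refine sum_congr rfl fun i _ => ?_
    rw [← TensorProduct.smul_tmul', map_zsmul, TensorProduct.sub_tmul, map_sub]
    simp only [sigmaD, Fin.ofNat_eq_cast, Fin.cast_val_eq_self, C.tmul_mk hp]

theorem tcompR_single (n p q : ℕ) (h : p + q = n + 1) (x : C.X p) (y : C.X q) :
    tcompR C n p q h (Finsupp.single x 1 ⊗ₜ[ℤ] Finsupp.single y 1) =
      ∑ b ∈ range q, (-1 : ℤ) ^ (b + 1) •
        (C.tmul n ⟨p, x⟩ (C.sigmaD b true ⟨q, y⟩) -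
          C.tmul n ⟨p, x⟩ (C.sigmaD b false ⟨q, y⟩)) := by
  cases q with
  | zero => simp [tcompR]
  | succ q =>
    have hp : p + q = n := by omega
    rw [← Fin.sum_univ_eq_sum_range (fun b => (-1 : ℤ) ^ (b + 1) •
        (C.tmul n ⟨p, x⟩ (C.sigmaD b true ⟨q + 1, y⟩) -
          C.tmul n ⟨p, x⟩ (C.sigmaD b false ⟨q + 1, y⟩)))]
    have hR : tcompR C n p (q + 1) h (Finsupp.single x 1 ⊗ₜ[ℤ] Finsupp.single y 1) =
        DirectSum.of (fun pq : TIdx n => TensorProduct ℤ (C.X pq.1.1 →₀ ℤ) (C.X pq.1.2 →₀ ℤ))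
          ⟨(p, q), hp⟩ (Finsupp.single x 1 ⊗ₜ[ℤ] Dhom C q (Finsupp.single y 1)) := rfl
    rw [hR, Dhom_single, TensorProduct.tmul_sum, map_sum]
    refine sum_congr rfl fun i _ => ?_
    rw [TensorProduct.tmul_smul, map_zsmul, TensorProduct.tmul_sub, map_sub]
    simp only [sigmaD, Fin.ofNat_eq_cast, Fin.cast_val_eq_self, C.tmul_mk hp]

theorem tdiffT_tmul (n : ℕ) (x y : Σ m, C.X m) (h : x.1 + y.1 = n + 1) :
    tdiffT C n (C.tmul (n + 1) x y) =
      ∑ a ∈ range x.1, (-1 : ℤ) ^ (a + 1) •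
        (C.tmul n (C.sigmaD a true x) y - C.tmul n (C.sigmaD a false x) y) +
      (-1 : ℤ) ^ x.1 • ∑ b ∈ range y.1, (-1 : ℤ) ^ (b + 1) •
        (C.tmul n x (C.sigmaD b true y) - C.tmul n x (C.sigmaD b false y)) := by
  rw [tmul, dif_pos h, tdiffT, DirectSum.toAddMonoid_of, AddMonoidHom.add_apply,
    AddMonoidHom.smul_apply, tcompL_single, tcompR_single]

theorem tdiffT_diag0 {n : ℕ} (u : C.X (n + 1)) :
    tdiffT C n (diag0 C u) = ∑ g : Fin (n + 1), (-1 : ℤ) ^ ((g : ℕ) + 1) •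
      (diag0 C (C.face n g true u) - diag0 C (C.face n g false u)) := by
  have hG : ∀ G : Finset (Fin (n + 1)),
      tdiffT C n (C.tmul (n + 1) (C.sigmaFace G false u) (C.sigmaFace Gᶜ true u)) =
      ∑ g ∈ G, (-1 : ℤ) ^ (rank G g + 1) •
        (C.tmul n (C.sigmaD (rank G g) true (C.sigmaFace G false u)) (C.sigmaFace Gᶜ true u) -
         C.tmul n (C.sigmaD (rank G g) false (C.sigmaFace G false u)) (C.sigmaFace Gᶜ true u)) +
      (-1 : ℤ) ^ G.card • ∑ g ∈ Gᶜ, (-1 : ℤ) ^ (rank Gᶜ g + 1) •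
        (C.tmul n (C.sigmaFace G false u) (C.sigmaD (rank Gᶜ g) true (C.sigmaFace Gᶜ true u)) -
         C.tmul n (C.sigmaFace G false u)
          (C.sigmaD (rank Gᶜ g) false (C.sigmaFace Gᶜ true u))) := by
    intro G
    rw [tdiffT_tmul _ _ _ _ (by simp [sigmaFace, card_add_card_compl])]
    rw [← sum_range_card G (fun a => (-1 : ℤ) ^ (a + 1) •
        (C.tmul n (C.sigmaD a true (C.sigmaFace G false u)) (C.sigmaFace Gᶜ true u) -
         C.tmul n (C.sigmaD a false (C.sigmaFace G false u)) (C.sigmaFace Gᶜ true u))),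
      ← sum_range_card Gᶜ (fun b => (-1 : ℤ) ^ (b + 1) •
        (C.tmul n (C.sigmaFace G false u) (C.sigmaD b true (C.sigmaFace Gᶜ true u)) -
         C.tmul n (C.sigmaFace G false u) (C.sigmaD b false (C.sigmaFace Gᶜ true u))))]
    rfl
  rw [diag0_eq, map_sum]
  simp only [map_zsmul, hG, smul_add, smul_sum, sum_add_distrib]
  have hswap : ∀ F : Finset (Fin (n + 1)) → Fin (n + 1) → TT C n,
      ∑ G, ∑ g ∈ G, F G g = ∑ g, ∑ H, F (insert g (skip g H)) g := by
    intro F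
    trans ∑ g, ∑ G with g ∈ G, F G g
    · exact sum_comm' (by simp)
    · exact sum_congr rfl fun g _ => sum_mem_eq_sum_insert_skip g (F · g)
  have hswap' : ∀ F : Finset (Fin (n + 1)) → Fin (n + 1) → TT C n,
      ∑ G, ∑ g ∈ Gᶜ, F G g = ∑ g, ∑ H, F (skip g H) g := by
    intro F
    trans ∑ g, ∑ G with g ∉ G, F G g
    · exact sum_comm' (by simp)
    · exact sum_congr rfl fun g _ => sum_notMem_eq_sum_skip g (F · g)
  have hsub : ∀ f g : Finset (Fin n) → TT C n, ∑ H, f H - ∑ H, g H = ∑ H, (f H - g H) :=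
    fun f g => (sum_sub_distrib f g).symm
  rw [hswap, hswap', ← sum_add_distrib]
  refine sum_congr rfl fun g _ => ?_
  rw [diag0_eq, diag0_eq, hsub, ← sum_add_distrib, smul_sum]
  refine sum_congr rfl fun H _ => ?_
  rw [compl_insert_skip, compl_skip, rank_insert_self, rank_insert_self]
  simp only [sigmaD_sigmaFace_insert, sigmaFace_skip, shuffleSign_insert_skip, shuffleSign_skip,
    card_map]
  have e := rank_skip_add_rank_skip_compl g H
  generalize rank (skip g H) g = a at *
  generalize rank (skip g Hᶜ) g = b at *
  rw [← e]
  have hs : ((-1 : ℤ) ^ H.card) * (-1) ^ H.card = 1 := by rw [← mul_pow]; simp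
  have ha : (-1 : ℤ) ^ b * (-1) ^ (a + 1) = (-1) ^ (a + b + 1) := by ring
  have hb : (-1 : ℤ) ^ (H.card + a) * ((-1) ^ H.card * (-1) ^ (b + 1)) = (-1) ^ (a + b + 1) := by
    linear_combination ((-1 : ℤ) ^ (a + b + 1)) * hs
  simp only [smul_smul, mul_assoc, ha, hb]
  module

theorem diag_single {n : ℕ} (u : C.X n) : diag C n (Finsupp.single u 1) = diag0 C u := by
  simp [_root_.diag]

end Precubical

/- The diagonal is a chain map from the cubical chain complex to its tensor square. -/
theorem diag_chain_map (C : Precubical) (n : ℕ) (c : C.X (n + 1) →₀ ℤ) :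
    diag C n (Dhom C n c) = tdiffT C n (diag C (n + 1) c) := by
  suffices h : (diag C n).comp (Dhom C n) = (tdiffT C n).comp (diag C (n + 1)) from
    DFunLike.congr_fun h c
  refine Finsupp.addHom_ext' fun u => AddMonoidHom.ext_int ?_
  change diag C n (Dhom C n (Finsupp.single u 1)) =
    tdiffT C n (diag C (n + 1) (Finsupp.single u 1))
  rw [C.diag_single, C.tdiffT_diag0, C.Dhom_single, map_sum]
  refine Finset.sum_congr rfl fun i _ => ?_
  rw [map_zsmul, map_sub, C.diag_single, C.diag_single]
end

section
/- The Leibniz rule holds for the cubical cup product: for φ ∈ C^p(X;R) and ψ ∈ C^q(X;R), δ(φ ⌣ ψ) = (δφ) ⌣ ψ + (−1)^p φ ⌣ (δψ), where δ is the cubical coboundary δ^n = Σ_{i=1}^{n+1} (−1)^i (δ_i^{n,1} − δ_i^{n,0}). -/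
open Finset

/-- Two successive faces of a cube, in directions named in either order, agree. -/
theorem Precubical.face_face_succAbove (C : Precubical) {n : ℕ} (i j : Fin (n + 2))
    (i' j' : Fin (n + 1)) (hi : j.succAbove i' = i) (hj : i.succAbove j' = j) (α β : Bool)
    (x : C.X (n + 2)) :
    C.face n i' α (C.face (n + 1) j β x) = C.face n j' β (C.face (n + 1) i α x) := by
  have hi' := congrArg Fin.val hi
  have hj' := congrArg Fin.val hj
  simp only [Fin.succAbove, Fin.lt_def, Fin.val_castSucc] at hi' hj'
  rcases lt_or_ge (i : ℕ) j with h | h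
  · have h1 : (i' : ℕ) = i := by
      split_ifs at hi' <;> simp at hi' <;> omega
    have h2 : (j' : ℕ) = j - 1 := by
      split_ifs at hj' <;> simp at hj' <;> omega
    rw [C.comm n i' j (by omega)]
    have e1 : (⟨(j : ℕ) - 1, by omega⟩ : Fin (n + 1)) = j' := Fin.ext h2.symm
    have e2 : (⟨(i' : ℕ), by omega⟩ : Fin (n + 2)) = i := Fin.ext h1
    rw [e1, e2]
  · have h1 : (j' : ℕ) = j := by
      split_ifs at hi' hj' <;> simp at hi' hj' <;> omega
    have h2 : (i' : ℕ) = i - 1 := by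
      split_ifs at hi' hj' <;> simp at hi' hj' <;> omega
    have h3 : (j' : ℕ) < i := by
      split_ifs at hi' hj' <;> simp at hi' hj' <;> omega
    rw [C.comm n j' i h3]
    have e1 : (⟨(i : ℕ) - 1, by omega⟩ : Fin (n + 1)) = i' := Fin.ext h2.symm
    have e2 : (⟨(j' : ℕ), by omega⟩ : Fin (n + 2)) = j := Fin.ext h1
    rw [e1, e2]

theorem Fin.succAbove_comp_succAbove {n : ℕ} (i j : Fin (n + 2)) (i' j' : Fin (n + 1))
    (hi : j.succAbove i' = i) (hj : i.succAbove j' = j) :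
    j.succAbove ∘ i'.succAbove = i.succAbove ∘ j'.succAbove := by
  funext k
  have hi' := congrArg Fin.val hi
  have hj' := congrArg Fin.val hj
  apply Fin.ext
  simp only [Fin.succAbove, Fin.lt_def, Fin.val_castSucc, Function.comp] at hi' hj' ⊢
  split_ifs at hi' hj' <;> simp at hi' hj' <;> split_ifs <;> simp_all <;> omega

open Classical in
/-- The face of a cube in which every coordinate `i` with `σ i = some ε` is set to `ε` and the
remaining coordinates are free. -/
noncomputable def Precubical.partialFace (C : Precubical) :
    (n : ℕ) → (Fin n → Option Bool) → C.X n → Sigma C.X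
  | 0, _, x => ⟨0, x⟩
  | n + 1, σ, x =>
      if h : ∃ (i : Fin (n + 1)) (ε : Bool), σ i = some ε then
        C.partialFace n (σ ∘ h.choose.succAbove) (C.face n h.choose h.choose_spec.choose x)
      else ⟨n + 1, x⟩

theorem Precubical.partialFace_of_forall_none (C : Precubical) {n : ℕ} (σ : Fin n → Option Bool)
    (h : ∀ i, σ i = none) (x : C.X n) : C.partialFace n σ x = ⟨n, x⟩ := by
  cases n with
  | zero => rfl
  | succ n => simp [partialFace, h]

theorem Precubical.partialFace_succ (C : Precubical) {n : ℕ} (σ : Fin (n + 1) → Option Bool)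
    (i : Fin (n + 1)) (ε : Bool) (hi : σ i = some ε) (x : C.X (n + 1)) :
    C.partialFace (n + 1) σ x = C.partialFace n (σ ∘ i.succAbove) (C.face n i ε x) := by
  induction n generalizing ε with
  | zero =>
    have h : ∃ (i : Fin (0 + 1)) (ε : Bool), σ i = some ε := ⟨i, ε, hi⟩
    rw [partialFace.eq_2, dif_pos h]
    have hj := h.choose_spec.choose_spec
    generalize h.choose_spec.choose = β at hj ⊢
    generalize h.choose = j at hj ⊢
    obtain rfl : i = j := Fin.ext (by omega)
    rw [hi] at hj
    rw [Option.some.inj hj]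
  | succ n ih =>
    have h : ∃ (i : Fin (n + 2)) (ε : Bool), σ i = some ε := ⟨i, ε, hi⟩
    rw [partialFace, dif_pos h]
    have hj := h.choose_spec.choose_spec
    generalize h.choose_spec.choose = β at hj ⊢
    generalize h.choose = j at hj ⊢
    by_cases hij : i = j
    · subst hij
      rw [hi] at hj
      rw [Option.some.inj hj]
    · obtain ⟨i', hi'⟩ := Fin.exists_succAbove_eq hij
      obtain ⟨j', hj'⟩ := Fin.exists_succAbove_eq (Ne.symm hij)
      rw [ih (σ ∘ j.succAbove) i' ε (by simp [hi', hi]),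
        ih (σ ∘ i.succAbove) j' β (by simp [hj', hj]),
        C.face_face_succAbove i j i' j' hi' hj', Function.comp_assoc, Function.comp_assoc,
        Fin.succAbove_comp_succAbove i j i' j' hi' hj']

/-- The assignment leaving the coordinates in `G` free and setting the others to `ε`. -/
def fixOutside {n : ℕ} (G : Finset (Fin n)) (ε : Bool) (i : Fin n) : Option Bool :=
  if i ∈ G then none else some ε

theorem Precubical.sigma_cast (C : Precubical) {m n : ℕ} (h : m = n) (x : C.X m) :
    (⟨n, cast (congrArg C.X h) x⟩ : Sigma C.X) = ⟨m, x⟩ := by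
  subst h; rfl

theorem succAbove_dropAt {m : ℕ} (i x : Fin (m + 1)) (hx : x ≠ i) :
    i.succAbove (dropAt i x hx) = x := by
  have hx' : (x : ℕ) ≠ (i : ℕ) := fun he => hx (Fin.ext he)
  apply Fin.ext
  unfold dropAt
  split_ifs with h
  · simp [Fin.succAbove, Fin.lt_def, h]
  · have : ¬ ((x : ℕ) - 1 < i) := by omega
    simp [Fin.succAbove, Fin.lt_def, this]
    omega

theorem sigma_mfaceAux (C : Precubical) (k : ℕ) {n : ℕ} (G : Finset (Fin n))
    (h : n - G.card = k) (ε : Bool) (x : C.X n) :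
    (⟨G.card, mfaceAux C k G h ε x⟩ : Sigma C.X) = C.partialFace n (fixOutside G ε) x := by
  induction k generalizing n with
  | zero =>
    have hG : G = univ := by
      rw [← Finset.card_eq_iff_eq_univ]
      have := Finset.card_le_univ G
      simp at this ⊢
      omega
    rw [C.partialFace_of_forall_none _ (by simp [fixOutside, hG])]
    rw [mfaceAux]
    exact C.sigma_cast (by simp [hG]) x
  | succ k ih =>
    cases n with
    | zero => omega
    | succ n =>
      have hne : Gᶜ.Nonempty := Finset.card_pos.mp (by
        rw [Finset.card_compl]; simp only [Fintype.card_fin]; omega)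
      have hiG : Gᶜ.max' hne ∉ G := by simpa using Gᶜ.max'_mem hne
      rw [C.partialFace_succ (fixOutside G ε) (Gᶜ.max' hne) ε (by simp [fixOutside, hiG]),
        mfaceAux, C.sigma_cast, ih]
      · congr 1
        funext y
        simp only [fixOutside, Function.comp]
        congr 1
        simp only [mem_image, mem_attach, true_and, Subtype.exists, eq_iff_iff]
        constructor
        · rintro ⟨a, ha, rfl⟩
          rwa [succAbove_dropAt]
        · intro hy
          exact ⟨_, hy, Fin.succAbove_right_injective (succAbove_dropAt _ _ _)⟩
      · rw [card_image_of_injective, card_attach]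
        intro a b hab
        have h := congrArg (Gᶜ.max' hne).succAbove hab
        simp only [succAbove_dropAt] at h
        exact Subtype.ext h

theorem sigma_mface (C : Precubical) {n : ℕ} (G : Finset (Fin n)) (ε : Bool) (x : C.X n) :
    (⟨G.card, mface C G ε x⟩ : Sigma C.X) = C.partialFace n (fixOutside G ε) x :=
  sigma_mfaceAux C _ G rfl ε x

section Cochain

variable {R : Type} [NonUnitalNonAssocRing R] {C : Precubical}

/-- Extension of a cochain by zero to cubes of all dimensions. -/
def extendZero {p : ℕ} (φ : C.X p → R) (x : Sigma C.X) : R :=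
  if h : x.1 = p then φ (cast (congrArg C.X h) x.2) else 0

/-- The coboundary of a cochain defined on cubes of all dimensions. -/
def totalCobnd (Φ : Sigma C.X → R) : Sigma C.X → R
  | ⟨0, _⟩ => 0
  | ⟨n + 1, x⟩ => ∑ i : Fin (n + 1), (-1 : ℤ) ^ ((i : ℕ) + 1) •
      (Φ ⟨n, C.face n i true x⟩ - Φ ⟨n, C.face n i false x⟩)

/-- The cup product of cochains defined on cubes of all dimensions. -/
noncomputable def totalCup (Φ Ψ : Sigma C.X → R) {n : ℕ} (u : C.X n) : R :=
  ∑ G : Finset (Fin n), shuffleSign G •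
    (Φ (C.partialFace n (fixOutside G false) u) * Ψ (C.partialFace n (fixOutside Gᶜ true) u))

theorem extendZero_cobnd {p : ℕ} (φ : C.X p → R) :
    extendZero (cobnd C φ) = totalCobnd (extendZero φ) := by
  funext ⟨n, x⟩
  cases n with
  | zero => simp [extendZero, totalCobnd]
  | succ n =>
    by_cases h : n = p
    · subst h
      simp [extendZero, totalCobnd, cobnd]
    · simp [extendZero, totalCobnd, h]

theorem extendZero_partialFace_of_card_ne {p n : ℕ} (φ : C.X p → R) (G : Finset (Fin n))
    (h : G.card ≠ p) (ε : Bool) (u : C.X n) :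
    extendZero φ (C.partialFace n (fixOutside G ε) u) = 0 := by
  rw [← sigma_mface]
  simp [extendZero, h]

theorem cup_eq_totalCup {p q : ℕ} (φ : C.X p → R) (ψ : C.X q → R) (u : C.X (p + q)) :
    cup C φ ψ u = totalCup (extendZero φ) (extendZero ψ) u := by
  refine Finset.sum_congr rfl fun G _ => ?_
  split_ifs with h
  · have h' : Gᶜ.card = q := by
      rw [Finset.card_compl]; simp only [Fintype.card_fin]; omega
    rw [← sigma_mface, ← sigma_mface]
    simp [extendZero, h, h']
  · rw [extendZero_partialFace_of_card_ne φ G h, zero_mul, smul_zero]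

theorem totalCup_cast (Φ Ψ : Sigma C.X → R) {m n : ℕ} (h : m = n) (u : C.X m) :
    totalCup Φ Ψ (cast (congrArg C.X h) u) = totalCup Φ Ψ u := by
  subst h; rfl

/-- The number of free coordinates of `σ` below `i`. -/
def freeBelow {n : ℕ} (σ : Fin n → Option Bool) (i : Fin n) : ℕ :=
  ∑ j : Fin n, if σ j = none ∧ j < i then 1 else 0

theorem totalCobnd_partialFace (Φ : Sigma C.X → R) {n : ℕ} (σ : Fin n → Option Bool)
    (u : C.X n) :
    totalCobnd Φ (C.partialFace n σ u) = ∑ i : Fin n, if σ i = none then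
      (-1 : ℤ) ^ (freeBelow σ i + 1) • (Φ (C.partialFace n (Function.update σ i (some true)) u) -
        Φ (C.partialFace n (Function.update σ i (some false)) u)) else 0 := by
  induction n with
  | zero => simp [Precubical.partialFace, totalCobnd]
  | succ n ih =>
    by_cases h : ∃ (j : Fin (n + 1)) (ε : Bool), σ j = some ε
    · obtain ⟨j, ε, hj⟩ := h
      rw [C.partialFace_succ σ j ε hj, ih, Fin.sum_univ_succAbove _ j]
      simp only [hj, reduceCtorEq, if_false, zero_add, Function.comp]
      refine Finset.sum_congr rfl fun i _ => ?_
      have hf : freeBelow σ (j.succAbove i) = freeBelow (σ ∘ j.succAbove) i := by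
        simp [freeBelow, Fin.sum_univ_succAbove _ j, hj, Fin.succAbove_lt_succAbove_iff]
      have hu (β : Bool) :
          C.partialFace (n + 1) (Function.update σ (j.succAbove i) (some β)) u =
            C.partialFace n (Function.update (σ ∘ j.succAbove) i (some β)) (C.face n j ε u) := by
        rw [C.partialFace_succ _ j ε
          (by rw [Function.update_of_ne (Fin.ne_succAbove j i), hj]),
          Function.update_comp_eq_of_injective _ Fin.succAbove_right_injective]
      rw [hf, hu, hu]
    · have hσ : ∀ i, σ i = none := by
        intro i
        rcases hi : σ i with _ | ε
        · rfl
        · exact absurd ⟨i, ε, hi⟩ h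
      rw [C.partialFace_of_forall_none σ hσ]
      refine Finset.sum_congr rfl fun i _ => ?_
      have hf : freeBelow σ i = i := by
        simp [freeBelow, hσ, ← Fin.card_Iio, Finset.filter_gt_eq_Iio]
      have hu (β : Bool) : C.partialFace (n + 1) (Function.update σ i (some β)) u =
          ⟨n, C.face n i β u⟩ := by
        rw [C.partialFace_succ _ i β (by simp), C.partialFace_of_forall_none]
        intro k
        simp [hσ, Fin.succAbove_ne]
      rw [if_pos (hσ i), hf, hu, hu]

end Cochain

/-- A sum over subsets of `Fin (n + 1)`, split according to membership of `i`. -/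
theorem sum_finset_fin_succ {M : Type*} [AddCommMonoid M] {n : ℕ} (i : Fin (n + 1))
    (f : Finset (Fin (n + 1)) → M) :
    ∑ H, f H = ∑ G : Finset (Fin n), f (G.map i.succAboveEmb) +
      ∑ G : Finset (Fin n), f (insert i (G.map i.succAboveEmb)) := by
  have h : (univ : Finset (Fin (n + 1))) = insert i (univ.map i.succAboveEmb) := by
    ext x
    rcases eq_or_ne x i with rfl | hx
    · simp
    · obtain ⟨y, rfl⟩ := Fin.exists_succAbove_eq hx
      simp
  rw [← Finset.powerset_univ, h, Finset.sum_powerset_insert (by simp [Fin.succAbove_ne])]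
  have hp : (univ.map i.succAboveEmb).powerset =
      (univ : Finset (Finset (Fin n))).map (Finset.mapEmbedding i.succAboveEmb).toEmbedding := by
    ext s
    simp only [mem_powerset, Finset.subset_map_iff, mem_map, mem_univ, true_and]
    simp [eq_comm]
  rw [hp, Finset.sum_map, Finset.sum_map]
  rfl

/-- The number of elements of `G` below `i` after making room for `i`. -/
def countBelow {n : ℕ} (G : Finset (Fin n)) (i : Fin (n + 1)) : ℕ :=
  ∑ j : Fin n, if j ∈ G ∧ i.succAbove j < i then 1 else 0

theorem countBelow_add_compl {n : ℕ} (G : Finset (Fin n)) (i : Fin (n + 1)) :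
    countBelow G i + countBelow Gᶜ i = i := by
  have h : (i : ℕ) = ∑ j : Fin (n + 1), if j < i then 1 else 0 := by
    simp [← Fin.card_Iio, Finset.filter_gt_eq_Iio]
  rw [Fin.sum_univ_succAbove _ i] at h
  rw [h, countBelow, countBelow, ← Finset.sum_add_distrib]
  simp only [lt_irrefl, if_false, zero_add]
  refine Finset.sum_congr rfl fun j _ => ?_
  by_cases hj : j ∈ G <;> simp [hj]

theorem shuffleSign_eq {n : ℕ} (G : Finset (Fin n)) :
    shuffleSign G = (-1) ^ (∑ g, ∑ k, if g ∈ G ∧ k ∉ G ∧ k < g then 1 else 0) := by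
  rw [shuffleSign]
  congr 1
  rw [← Finset.sum_filter_add_sum_filter_not univ (· ∈ G)]
  rw [Finset.sum_eq_zero (s := univ.filter (· ∉ G)) (by simp +contextual)]
  simp only [Finset.filter_univ_mem, add_zero]
  refine Finset.sum_congr rfl fun g hg => ?_
  simp only [hg, true_and, Finset.card_filter]
  rw [← Finset.sum_filter, ← Finset.sum_filter]
  congr 1
  ext; simp

theorem shuffleSign_insert {n : ℕ} (G : Finset (Fin n)) (i : Fin (n + 1)) :
    shuffleSign (insert i (G.map i.succAboveEmb)) =
      (-1) ^ countBelow Gᶜ i * shuffleSign G := by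
  rw [shuffleSign_eq, shuffleSign_eq, ← pow_add]
  congr 1
  rw [Fin.sum_univ_succAbove _ i]
  simp only [Fin.sum_univ_succAbove _ i]
  simp [countBelow, Fin.succAbove_ne, Fin.succAbove_lt_succAbove_iff]

theorem shuffleSign_map {n : ℕ} (G : Finset (Fin n)) (i : Fin (n + 1)) :
    shuffleSign (G.map i.succAboveEmb) =
      (-1) ^ (G.card + countBelow G i) * shuffleSign G := by
  have h : (-1 : ℤ) ^ (G.card + countBelow G i) =
      (-1) ^ (∑ j : Fin n, if j ∈ G ∧ i < i.succAbove j then 1 else 0) := by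
    have : G.card = countBelow G i + ∑ j : Fin n, if j ∈ G ∧ i < i.succAbove j then 1 else 0 := by
      rw [countBelow, ← Finset.sum_add_distrib, ← Finset.filter_univ_mem G, Finset.card_filter]
      refine Finset.sum_congr rfl fun j _ => ?_
      by_cases hj : j ∈ G
      · rcases lt_or_gt_of_ne (Fin.succAbove_ne i j) with h | h <;> simp [hj, h, h.le]
      · simp [hj]
    rw [this, add_right_comm, pow_add, Even.neg_one_pow ⟨_, rfl⟩, one_mul]
  rw [h, shuffleSign_eq, shuffleSign_eq, ← pow_add]
  congr 1
  rw [Fin.sum_univ_succAbove _ i]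
  simp only [Fin.sum_univ_succAbove _ i]
  simp [Fin.succAbove_ne, Fin.succAbove_lt_succAbove_iff, Finset.sum_add_distrib]

theorem fixOutside_comp_succAbove {n : ℕ} (i : Fin (n + 1)) {H : Finset (Fin (n + 1))}
    {G : Finset (Fin n)} (h : ∀ k, i.succAbove k ∈ H ↔ k ∈ G) (ε : Bool) :
    fixOutside H ε ∘ i.succAbove = fixOutside G ε := by
  funext k
  simp [fixOutside, h]

theorem freeBelow_fixOutside {n : ℕ} (i : Fin (n + 1)) {H : Finset (Fin (n + 1))}
    {G : Finset (Fin n)} (h : ∀ k, i.succAbove k ∈ H ↔ k ∈ G) (ε : Bool) :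
    freeBelow (fixOutside H ε) i = countBelow G i := by
  simp [freeBelow, countBelow, Fin.sum_univ_succAbove _ i, fixOutside, h]

theorem Precubical.partialFace_fixOutside (C : Precubical) {n : ℕ} (i : Fin (n + 1))
    {H : Finset (Fin (n + 1))} {G : Finset (Fin n)} (h : ∀ k, i.succAbove k ∈ H ↔ k ∈ G)
    (hi : i ∉ H) (ε : Bool) (u : C.X (n + 1)) :
    C.partialFace (n + 1) (fixOutside H ε) u =
      C.partialFace n (fixOutside G ε) (C.face n i ε u) := by
  rw [C.partialFace_succ _ i ε (by simp [fixOutside, hi]), fixOutside_comp_succAbove i h]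

theorem Precubical.partialFace_update_fixOutside (C : Precubical) {n : ℕ} (i : Fin (n + 1))
    {H : Finset (Fin (n + 1))} {G : Finset (Fin n)} (h : ∀ k, i.succAbove k ∈ H ↔ k ∈ G)
    (ε β : Bool) (u : C.X (n + 1)) :
    C.partialFace (n + 1) (Function.update (fixOutside H ε) i (some β)) u =
      C.partialFace n (fixOutside G ε) (C.face n i β u) := by
  rw [C.partialFace_succ _ i β (by simp), ← fixOutside_comp_succAbove i h]
  congr 1
  funext k
  simp [Fin.succAbove_ne]

section Leibniz

variable {R : Type} [NonUnitalNonAssocRing R] {C : Precubical}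

theorem totalCup_totalCobnd_left (Φ Ψ : Sigma C.X → R) {n : ℕ} (u : C.X (n + 1)) :
    totalCup (totalCobnd Φ) Ψ u = ∑ i : Fin (n + 1), ∑ G : Finset (Fin n),
      ((-1) ^ ((i : ℕ) + 1) * shuffleSign G) •
        ((Φ (C.partialFace n (fixOutside G false) (C.face n i true u)) -
          Φ (C.partialFace n (fixOutside G false) (C.face n i false u))) *
          Ψ (C.partialFace n (fixOutside Gᶜ true) (C.face n i true u))) := by
  simp only [totalCup, totalCobnd_partialFace, Finset.sum_mul, Finset.smul_sum]
  rw [Finset.sum_comm]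
  refine Finset.sum_congr rfl fun i _ => ?_
  rw [sum_finset_fin_succ i, Finset.sum_eq_zero (by simp [fixOutside, Fin.succAbove_ne]), zero_add]
  refine Finset.sum_congr rfl fun G _ => ?_
  have hG (k : Fin n) : i.succAbove k ∈ insert i (G.map i.succAboveEmb) ↔ k ∈ G := by
    simp [Fin.succAbove_ne]
  have hGc (k : Fin n) : i.succAbove k ∈ (insert i (G.map i.succAboveEmb))ᶜ ↔ k ∈ Gᶜ := by
    simp [Fin.succAbove_ne]
  rw [if_pos (by simp [fixOutside]), freeBelow_fixOutside i hG,
    C.partialFace_update_fixOutside i hG, C.partialFace_update_fixOutside i hG,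
    C.partialFace_fixOutside i hGc (by simp), smul_mul_assoc, smul_smul, shuffleSign_insert,
    ← countBelow_add_compl G i]
  congr 1
  ring

theorem sum_smul_mul_totalCobnd (Φ Ψ : Sigma C.X → R) {n : ℕ} (u : C.X (n + 1)) :
    ∑ H : Finset (Fin (n + 1)), (-1 : ℤ) ^ H.card • shuffleSign H •
      (Φ (C.partialFace (n + 1) (fixOutside H false) u) *
        totalCobnd Ψ (C.partialFace (n + 1) (fixOutside Hᶜ true) u)) =
    ∑ i : Fin (n + 1), ∑ G : Finset (Fin n),
      ((-1) ^ ((i : ℕ) + 1) * shuffleSign G) •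
        (Φ (C.partialFace n (fixOutside G false) (C.face n i false u)) *
          (Ψ (C.partialFace n (fixOutside Gᶜ true) (C.face n i true u)) -
          Ψ (C.partialFace n (fixOutside Gᶜ true) (C.face n i false u)))) := by
  simp only [totalCobnd_partialFace, Finset.mul_sum, Finset.smul_sum]
  rw [Finset.sum_comm]
  refine Finset.sum_congr rfl fun i _ => ?_
  rw [sum_finset_fin_succ i, add_comm, Finset.sum_eq_zero (by simp [fixOutside]), zero_add]
  refine Finset.sum_congr rfl fun G _ => ?_
  have hG (k : Fin n) : i.succAbove k ∈ G.map i.succAboveEmb ↔ k ∈ G := by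
    simp
  have hGc (k : Fin n) : i.succAbove k ∈ (G.map i.succAboveEmb)ᶜ ↔ k ∈ Gᶜ := by
    simp
  rw [if_pos (by simp [fixOutside, Fin.succAbove_ne]), freeBelow_fixOutside i hGc,
    C.partialFace_update_fixOutside i hGc, C.partialFace_update_fixOutside i hGc,
    C.partialFace_fixOutside i hG (by simp [Fin.succAbove_ne]), mul_smul_comm, smul_smul,
    smul_smul, shuffleSign_map, ← countBelow_add_compl G i, card_map]
  congr 1
  have hsq : (-1 : ℤ) ^ G.card * (-1) ^ G.card = 1 := by
    rw [← pow_add, Even.neg_one_pow ⟨_, rfl⟩]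
  linear_combination (-1) ^ (countBelow G i + countBelow Gᶜ i + 1) * shuffleSign G * hsq

/-- The Leibniz rule for cochains defined on cubes of all dimensions. -/
theorem cobnd_totalCup (Φ Ψ : Sigma C.X → R) {n : ℕ} (u : C.X (n + 1)) :
    cobnd C (totalCup Φ Ψ) u = totalCup (totalCobnd Φ) Ψ u +
      ∑ H : Finset (Fin (n + 1)), (-1 : ℤ) ^ H.card • shuffleSign H •
        (Φ (C.partialFace (n + 1) (fixOutside H false) u) *
          totalCobnd Ψ (C.partialFace (n + 1) (fixOutside Hᶜ true) u)) := by
  rw [totalCup_totalCobnd_left, sum_smul_mul_totalCobnd, cobnd, ← Finset.sum_add_distrib]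
  refine Finset.sum_congr rfl fun i _ => ?_
  rw [totalCup, totalCup, ← Finset.sum_sub_distrib, ← Finset.sum_add_distrib, Finset.smul_sum]
  refine Finset.sum_congr rfl fun G _ => ?_
  rw [← smul_sub, ← smul_add, smul_smul, sub_mul, mul_sub, sub_add_sub_cancel]

end Leibniz

/- The Leibniz rule `δ(φ ⌣ ψ) = (δφ) ⌣ ψ + (−1)^p φ ⌣ (δψ)` for the cubical cup product. -/
theorem cup_leibniz (C : Precubical) (R : Type) [Ring R] (p q : ℕ)
    (φ : C.X p → R) (ψ : C.X q → R) (u : C.X (p + q + 1)) :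
    cobnd C (cup C φ ψ) u =
      cup C (cobnd C φ) ψ (cast (congrArg C.X (show p + q + 1 = p + 1 + q by omega)) u) +
        (-1 : ℤ) ^ p • cup C φ (cobnd C ψ) u := by
  have h : cup C φ ψ = totalCup (extendZero φ) (extendZero ψ) := funext (cup_eq_totalCup φ ψ)
  have h' : cup C φ (cobnd C ψ) u = totalCup (extendZero φ) (extendZero (cobnd C ψ)) u :=
    cup_eq_totalCup φ (cobnd C ψ) u
  rw [h, cobnd_totalCup, cup_eq_totalCup, totalCup_cast _ _ (by omega),
    extendZero_cobnd, h', extendZero_cobnd]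
  congr 1
  rw [totalCup, Finset.smul_sum]
  refine Finset.sum_congr rfl fun H _ => ?_
  by_cases hH : H.card = p
  · rw [hH]
  · rw [extendZero_partialFace_of_card_ne φ H hH, zero_mul, smul_zero, smul_zero, smul_zero]
end
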